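/- arXiv:2009.11704 — 2 statements merged into one kernel-verified Lean document; each statement's English description precedes it below -/
import Mathlib

section
/- For all integers p ≥ 1 and q ≥ 2, the non-alternating linear Euler S̃-sum is the following combination of classical linear Euler sums: S̃_{p,q} = (2^{p+q−1} − 1) · S_{p,q} − 2^{p+q−1} · S_{p,q̄}, where S_{p,q} = ∑_{n=1}^∞ H_n^{(p)}/n^q and S_{p,q̄} = ∑_{n=1}^∞ (−1)^{n−1} H_n^{(p)}/n^q. -/
open scoped BigOperators

/-- Generalized harmNum number `H_n^{(p)} = ∑_{k=1}^n 1/k^p`. -/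
noncomputable def harmNum (n p : ℕ) : ℝ :=
  ∑ k ∈ Finset.range n, 1 / ((k : ℝ) + 1) ^ p

/-- Odd harmNum number `h_n^{(p)} = ∑_{k=1}^n 1/(k-1/2)^p`. -/
noncomputable def oddHarmonic (n p : ℕ) : ℝ :=
  ∑ k ∈ Finset.range n, 1 / ((k : ℝ) + 1 / 2) ^ p

/-- Non-alternating linear Euler S̃-sum `S̃_{p,q} = ∑_{n≥1} h_n^{(p)}/n^q`. -/
noncomputable def SSum (p q : ℕ) : ℝ :=
  ∑' n : ℕ, oddHarmonic (n + 1) p / ((n : ℝ) + 1) ^ q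

/-- Classical linear Euler sum `S_{p,q} = ∑_{n≥1} H_n^{(p)}/n^q`. -/
noncomputable def eulerS (p q : ℕ) : ℝ :=
  ∑' n : ℕ, harmNum (n + 1) p / ((n : ℝ) + 1) ^ q

/-- Alternating classical linear Euler sum `S_{p,q̄} = ∑_{n≥1} (-1)^{n-1} H_n^{(p)}/n^q`. -/
noncomputable def eulerSAlt (p q : ℕ) : ℝ :=
  ∑' n : ℕ, (-1 : ℝ) ^ n * harmNum (n + 1) p / ((n : ℝ) + 1) ^ q

theorem harm_bound (p : ℕ) (hp : 1 ≤ p) (n : ℕ) : harmNum n p ≤ 2 * Real.sqrt n := by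
  induction n with
  | zero => simp [harmNum]
  | succ n ih =>
    unfold harmNum at ih ⊢
    rw [Finset.sum_range_succ]
    have h1 : 1 / ((n : ℝ) + 1) ^ p ≤ 1 / ((n : ℝ) + 1) := by
      apply one_div_le_one_div_of_le (by positivity)
      apply le_self_pow₀ (by linarith [(Nat.cast_nonneg n : (0:ℝ) ≤ n)]) (by omega)
    have h2 : 1 / ((n : ℝ) + 1) ≤ 2 * (Real.sqrt (n + 1) - Real.sqrt n) := by
      have hn : (0:ℝ) ≤ n := Nat.cast_nonneg n
      set a := Real.sqrt (n + 1)
      set b := Real.sqrt n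
      have ha : a ^ 2 = n + 1 := Real.sq_sqrt (by positivity)
      have hb : b ^ 2 = n := Real.sq_sqrt hn
      have hb0 : 0 ≤ b := Real.sqrt_nonneg _
      have hba : b ≤ a := Real.sqrt_le_sqrt (by linarith)
      have ha1 : 1 ≤ a := Real.one_le_sqrt.2 (by linarith)
      rw [div_le_iff₀ (by positivity), ← ha]
      have h3 : (a - b) * (a + b) = 1 := by nlinarith
      have h4 : a + b ≤ 2 * a ^ 2 := by nlinarith
      nlinarith [mul_le_mul_of_nonneg_left h4 (sub_nonneg.2 hba)]
    push_cast
    linarith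

theorem harm_nonneg (n p : ℕ) : 0 ≤ harmNum n p := by
  unfold harmNum
  positivity

theorem harm_summable (p q : ℕ) (hp : 1 ≤ p) (hq : 2 ≤ q) :
    Summable (fun n : ℕ => harmNum (n + 1) p / ((n : ℝ) + 1) ^ q) := by
  have h0 : Summable (fun n : ℕ => 2 * (1 / ((n + 1 : ℕ) : ℝ) ^ (3 / 2 : ℝ))) :=
    ((summable_nat_add_iff 1).2
      (Real.summable_one_div_nat_rpow.2 (by norm_num : (1:ℝ) < 3 / 2))).mul_left 2
  refine Summable.of_nonneg_of_le (fun n => div_nonneg (harm_nonneg _ _) (by positivity)) ?_ h0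
  intro n
  have hb := harm_bound p hp (n + 1)
  push_cast at hb ⊢
  have hx : (1:ℝ) ≤ (n:ℝ) + 1 := by linarith [(Nat.cast_nonneg n : (0:ℝ) ≤ n)]
  have hx0 : (0:ℝ) < (n:ℝ) + 1 := by linarith
  have h2 : ((n:ℝ) + 1) ^ 2 ≤ ((n:ℝ) + 1) ^ q := pow_le_pow_right₀ hx hq
  have h3 : Real.sqrt ((n:ℝ) + 1) * ((n:ℝ) + 1) ^ (3 / 2 : ℝ) = ((n:ℝ) + 1) ^ 2 := by
    rw [Real.sqrt_eq_rpow, ← Real.rpow_add hx0, ← Real.rpow_natCast]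
    norm_num
  rw [mul_one_div, div_le_div_iff₀ (by positivity) (by positivity)]
  calc harmNum (n + 1) p * ((n:ℝ) + 1) ^ (3 / 2 : ℝ)
      ≤ (2 * Real.sqrt ((n:ℝ) + 1)) * ((n:ℝ) + 1) ^ (3 / 2 : ℝ) := by gcongr
    _ = 2 * ((n:ℝ) + 1) ^ 2 := by rw [mul_assoc, h3]
    _ ≤ _ := by linarith

theorem harm_double (p m : ℕ) :
    2 ^ p * harmNum (2 * m) p = oddHarmonic m p + harmNum m p := by
  induction m with
  | zero => simp [harmNum, oddHarmonic]
  | succ m ih =>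
    unfold harmNum oddHarmonic at ih ⊢
    rw [show 2 * (m + 1) = 2 * m + 1 + 1 by ring, Finset.sum_range_succ, Finset.sum_range_succ,
      Finset.sum_range_succ _ m, Finset.sum_range_succ _ m, mul_add, mul_add, ih]
    have e1 : (2:ℝ) ^ p * (1 / (((2 * m : ℕ) : ℝ) + 1) ^ p) = 1 / ((m : ℝ) + 1 / 2) ^ p := by
      rw [show (((2 * m : ℕ) : ℝ) + 1) = 2 * ((m : ℝ) + 1 / 2) by push_cast; ring, mul_pow]
      field_simp
    have e2 : (2:ℝ) ^ p * (1 / (((2 * m + 1 : ℕ) : ℝ) + 1) ^ p) = 1 / ((m : ℝ) + 1) ^ p := by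
      rw [show (((2 * m + 1 : ℕ) : ℝ) + 1) = 2 * ((m : ℝ) + 1) by push_cast; ring, mul_pow]
      field_simp
    rw [e1, e2]
    ring

theorem stmt14 (p q : ℕ) (hp : 1 ≤ p) (hq : 2 ≤ q) :
    SSum p q = (2 ^ (p + q - 1) - 1) * eulerS p q - 2 ^ (p + q - 1) * eulerSAlt p q := by
  have hS := harm_summable p q hp hq
  set f : ℕ → ℝ := fun n : ℕ => harmNum (n + 1) p / ((n : ℝ) + 1) ^ q with hf
  have he : Summable (fun k => f (2 * k)) :=
    hS.comp_injective (fun a b h => by simpa using h)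
  have ho : Summable (fun k => f (2 * k + 1)) :=
    hS.comp_injective (i := fun k : ℕ => 2 * k + 1) (fun a b h => by simpa using h)
  have hSe : eulerS p q = ∑' k, f (2 * k) + ∑' k, f (2 * k + 1) :=
    (tsum_even_add_odd he ho).symm
  have hA : eulerSAlt p q = ∑' k, f (2 * k) - ∑' k, f (2 * k + 1) := by
    have e1 : ∀ k, (-1 : ℝ) ^ (2 * k) * f (2 * k) = f (2 * k) := by
      intro k; simp [pow_mul]
    have e2 : ∀ k, (-1 : ℝ) ^ (2 * k + 1) * f (2 * k + 1) = - f (2 * k + 1) := by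
      intro k; simp [pow_succ, pow_mul]
    have := tsum_even_add_odd (f := fun n => (-1 : ℝ) ^ n * f n)
      (by simpa only [e1] using he) (by simpa only [e2] using ho.neg)
    simp only [e1, e2, tsum_neg] at this
    rw [sub_eq_add_neg, this]
    unfold eulerSAlt
    simp only [hf, mul_div_assoc]
  have hO : SSum p q = 2 ^ (p + q) * ∑' k, f (2 * k + 1) - eulerS p q := by
    unfold SSum eulerS
    rw [← tsum_mul_left, ← (ho.mul_left _).tsum_sub hS]
    congr 1
    funext k
    have hd := harm_double p (k + 1)
    have e : oddHarmonic (k + 1) p = 2 ^ p * harmNum (2 * (k + 1)) p - harmNum (k + 1) p := by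
      linarith
    simp only [hf]
    rw [e, show 2 * k + 1 + 1 = 2 * (k + 1) by ring,
      show (((2 * k + 1 : ℕ) : ℝ) + 1) = 2 * ((k : ℝ) + 1) by push_cast; ring, mul_pow, pow_add]
    field_simp
  obtain ⟨r, hr⟩ : ∃ r, p + q = r + 1 := ⟨p + q - 1, by omega⟩
  rw [hO, hA, hSe, hr, Nat.add_sub_cancel, pow_succ]
  ring
end

section
/- For all integers p ≥ 1 and q ≥ 2, the non-alternating linear Euler S̃-sum satisfies S̃_{p,q} = (2^{p+q−1} − 1) · ( ζ(q,p) + ζ(p+q) ) + 2^{p+q−1} · ( ζ̄(q,p) + ζ̄(p+q) ), where ζ(q,p) = ∑_{n>k≥1} 1/(n^q k^p), ζ̄(q,p) = ∑_{n>k≥1} (−1)^n/(n^q k^p), ζ(p+q) = ∑_{n=1}^∞ 1/n^{p+q}, and ζ̄(p+q) = ∑_{n=1}^∞ (−1)^n/n^{p+q}. -/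
open scoped BigOperators

/-- Double zeta value `ζ(q,p) = ∑_{n>k≥1} 1/(n^q k^p)`. -/
noncomputable def dzeta (q p : ℕ) : ℝ :=
  ∑' x : {y : ℕ × ℕ // 0 < y.2 ∧ y.2 < y.1},
    1 / ((x.1.1 : ℝ) ^ q * (x.1.2 : ℝ) ^ p)

/-- Alternating double zeta value `ζ̄(q,p) = ∑_{n>k≥1} (-1)^n/(n^q k^p)`. -/
noncomputable def dzetaAlt (q p : ℕ) : ℝ :=
  ∑' x : {y : ℕ × ℕ // 0 < y.2 ∧ y.2 < y.1},
    (-1 : ℝ) ^ (x.1.1) / ((x.1.1 : ℝ) ^ q * (x.1.2 : ℝ) ^ p)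

/-- Zeta value `ζ(s) = ∑_{n≥1} 1/n^s`. -/
noncomputable def zetaVal (s : ℕ) : ℝ := ∑' n : ℕ, 1 / ((n : ℝ) + 1) ^ s

/-- Alternating zeta value `ζ̄(s) = ∑_{n≥1} (-1)^n/n^s`. -/
noncomputable def zetaAltVal (s : ℕ) : ℝ := ∑' n : ℕ, (-1 : ℝ) ^ (n + 1) / ((n : ℝ) + 1) ^ s

/-- Harmonic sums including the (vanishing) zeroth term. -/
noncomputable def auxH (p n : ℕ) : ℝ := ∑ k ∈ Finset.range (n + 1), 1 / (k : ℝ) ^ p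

lemma auxH_nonneg (p n : ℕ) : 0 ≤ auxH p n :=
  Finset.sum_nonneg fun k _ => by positivity

lemma auxH_le (p : ℕ) (hp : 1 ≤ p) (n : ℕ) : auxH p n ≤ 2 * Real.sqrt n := by
  induction n with
  | zero => simp [auxH, show p ≠ 0 by omega]
  | succ n ih =>
    have h1 : auxH p (n + 1) = auxH p n + 1 / ((n + 1 : ℕ) : ℝ) ^ p := by
      unfold auxH; rw [Finset.sum_range_succ]
    rw [h1]
    have h2 : 1 / ((n + 1 : ℕ) : ℝ) ^ p ≤ 1 / ((n + 1 : ℕ) : ℝ) := by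
      apply one_div_le_one_div_of_le (by positivity)
      apply le_self_pow₀ _ (by omega)
      exact_mod_cast Nat.succ_le_succ (Nat.zero_le n)
    have h3 : 1 / ((n + 1 : ℕ) : ℝ) ≤ 2 * Real.sqrt ((n + 1 : ℕ) : ℝ) - 2 * Real.sqrt n := by
      have hs : Real.sqrt ((n + 1 : ℕ) : ℝ) ^ 2 = (n : ℝ) + 1 := by
        rw [Real.sq_sqrt (by positivity)]; push_cast; ring
      have ht : Real.sqrt (n : ℝ) ^ 2 = (n : ℝ) := Real.sq_sqrt (by positivity)
      have hs1 : 1 ≤ Real.sqrt ((n + 1 : ℕ) : ℝ) := by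
        rw [Real.one_le_sqrt]; push_cast; linarith [(Nat.cast_nonneg n : (0:ℝ) ≤ n)]
      have ht0 := Real.sqrt_nonneg (n : ℝ)
      have hc : ((n + 1 : ℕ) : ℝ) = Real.sqrt ((n + 1 : ℕ) : ℝ) ^ 2 := by
        rw [hs]; push_cast; ring
      set s := Real.sqrt ((n + 1 : ℕ) : ℝ)
      set t := Real.sqrt (n : ℝ)
      rw [hc, div_le_iff₀ (by positivity)]
      have hst : (s - t) * (s + t) = 1 := by nlinarith
      have hts : t ≤ s := by nlinarith
      nlinarith [mul_nonneg (sub_nonneg.2 hts) (sub_nonneg.2 hs1), mul_nonneg (mul_nonneg (sub_nonneg.2 hts) (sub_nonneg.2 hs1)) (by linarith : 0 ≤ s)]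
    linarith

lemma auxA_summable (p q : ℕ) (hp : 1 ≤ p) (hq : 2 ≤ q) :
    Summable fun n : ℕ => auxH p n / (n : ℝ) ^ q := by
  have h := (Real.summable_nat_rpow_inv (p := 3 / 2)).2 (by norm_num)
  refine Summable.of_nonneg_of_le (fun n => div_nonneg (auxH_nonneg p n) (by positivity)) ?_
    (h.mul_left 2)
  intro n
  rcases Nat.eq_zero_or_pos n with rfl | hn
  · simp [show q ≠ 0 by omega]
  have hn' : (1 : ℝ) ≤ n := by exact_mod_cast hn
  have h0 : (0 : ℝ) < n := by linarith
  calc auxH p n / (n : ℝ) ^ q ≤ (2 * Real.sqrt n) / (n : ℝ) ^ 2 := by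
        apply div_le_div₀ (by positivity) (auxH_le p hp n) (by positivity)
        exact pow_le_pow_right₀ hn' hq
    _ = 2 * ((n : ℝ) ^ (3 / 2 : ℝ))⁻¹ := by
        rw [Real.sqrt_eq_rpow, ← Real.rpow_neg h0.le, ← Real.rpow_natCast, mul_div_assoc,
          ← Real.rpow_sub h0]
        norm_num

lemma aux_double (p q : ℕ) (hp : 1 ≤ p) (hq : 2 ≤ q) (c : ℕ → ℝ) (hc : ∀ n, |c n| = 1) :
    (∑' x : {y : ℕ × ℕ // 0 < y.2 ∧ y.2 < y.1},
      c x.1.1 / ((x.1.1 : ℝ) ^ q * (x.1.2 : ℝ) ^ p))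
      + ∑' n : ℕ, c (n + 1) / ((n : ℝ) + 1) ^ (p + q)
      = ∑' n : ℕ, c n * (auxH p n / (n : ℝ) ^ q) := by
  have hp0 : p ≠ 0 := by omega
  have hq0 : q ≠ 0 := by omega
  let F : ℕ × ℕ → ℝ := fun y => if y.2 < y.1 then c y.1 / ((y.1 : ℝ) ^ q * (y.2 : ℝ) ^ p) else 0
  have e1 : (∑' x : {y : ℕ × ℕ // 0 < y.2 ∧ y.2 < y.1},
      c x.1.1 / ((x.1.1 : ℝ) ^ q * (x.1.2 : ℝ) ^ p)) = ∑' y, F y := by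
    have := tsum_subtype {y : ℕ × ℕ | 0 < y.2 ∧ y.2 < y.1}
      (fun y => c y.1 / ((y.1 : ℝ) ^ q * (y.2 : ℝ) ^ p))
    refine Eq.trans this ?_
    congr 1
    ext ⟨n, k⟩
    simp only [F, Set.indicator_apply, Set.mem_ofPred_eq]
    rcases Nat.eq_zero_or_pos k with rfl | hk
    · simp [hp0]
    · simp [hk]
  have hin : ∀ n, ∀ k ∉ Finset.range n, F (n, k) = 0 := by
    intro n k hk
    simp only [Finset.mem_range] at hk
    simp [F, hk]
  have hrow : ∀ n, ∑ k ∈ Finset.range n, F (n, k)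
      = c n * ((∑ k ∈ Finset.range n, 1 / (k : ℝ) ^ p) / (n : ℝ) ^ q) := by
    intro n
    rw [Finset.sum_div, Finset.mul_sum]
    refine Finset.sum_congr rfl fun k hk => ?_
    simp only [F, if_pos (Finset.mem_range.1 hk)]
    rw [div_div, mul_one_div, mul_comm ((n : ℝ) ^ q)]
  have hHle : ∀ n, auxH p n = (∑ k ∈ Finset.range n, 1 / (k : ℝ) ^ p) + 1 / (n : ℝ) ^ p := by
    intro n; unfold auxH; rw [Finset.sum_range_succ]
  have hA := auxA_summable p q hp hq
  have hdiag : Summable fun n : ℕ => 1 / (n : ℝ) ^ (p + q) :=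
    Real.summable_one_div_nat_pow.2 (by omega)
  have hsplit : ∀ n : ℕ, auxH p n / (n : ℝ) ^ q
      = (∑ k ∈ Finset.range n, 1 / (k : ℝ) ^ p) / (n : ℝ) ^ q + 1 / (n : ℝ) ^ (p + q) := by
    intro n; rw [hHle, add_div, div_div, pow_add]
  have hB : Summable fun n : ℕ => (∑ k ∈ Finset.range n, 1 / (k : ℝ) ^ p) / (n : ℝ) ^ q := by
    refine (hA.sub hdiag).congr fun n => ?_
    rw [hsplit]; ring
  have hcs : ∀ f : ℕ → ℝ, (∀ n, 0 ≤ f n) → Summable f → Summable fun n => c n * f n := by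
    intro f h0 hf
    refine Summable.of_norm (hf.congr fun n => ?_)
    rw [Real.norm_eq_abs, abs_mul, hc, one_mul, abs_of_nonneg (h0 n)]
  have hFs : Summable F := by
    refine Summable.of_norm ?_
    rw [summable_prod_of_nonneg (fun y => norm_nonneg _)]
    have hfin : ∀ n, ∀ k ∉ Finset.range n, ‖F (n, k)‖ = 0 := fun n k hk => by
      rw [hin n k hk, norm_zero]
    refine ⟨fun n => summable_of_ne_finset_zero (s := Finset.range n) (hfin n), ?_⟩
    refine hB.congr fun n => ?_
    rw [tsum_eq_sum (hfin n), Finset.sum_div]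
    refine Finset.sum_congr rfl fun k hk => ?_
    simp only [F, if_pos (Finset.mem_range.1 hk)]
    rw [Real.norm_eq_abs, abs_div, hc, abs_of_nonneg (by positivity), div_div,
      mul_comm ((n : ℝ) ^ q)]
  have e2 : ∑' y, F y
      = ∑' n : ℕ, c n * ((∑ k ∈ Finset.range n, 1 / (k : ℝ) ^ p) / (n : ℝ) ^ q) := by
    rw [hFs.tsum_prod]
    refine tsum_congr fun n => ?_
    rw [tsum_eq_sum (hin n), hrow]
  have hcd := hcs _ (fun n => by positivity) hdiag
  have e3 : ∑' n : ℕ, c (n + 1) / ((n : ℝ) + 1) ^ (p + q)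
      = ∑' n : ℕ, c n * (1 / (n : ℝ) ^ (p + q)) := by
    rw [hcd.tsum_eq_zero_add]
    simp [hp0, div_eq_mul_inv]
  rw [e1, e2, e3, ← (hcs _ (fun n => by positivity) hB).tsum_add hcd]
  refine tsum_congr fun n => ?_
  rw [hsplit]; ring

lemma auxH_two (p n : ℕ) (hp : 1 ≤ p) :
    2 ^ p * auxH p (2 * n) = oddHarmonic n p + auxH p n := by
  induction n with
  | zero => simp [auxH, oddHarmonic, show p ≠ 0 by omega]
  | succ n ih =>
    have h1 : auxH p (2 * (n + 1)) = auxH p (2 * n) + 1 / ((2 * n + 1 : ℕ) : ℝ) ^ p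
        + 1 / ((2 * n + 2 : ℕ) : ℝ) ^ p := by
      unfold auxH
      rw [show 2 * (n + 1) + 1 = 2 * n + 1 + 1 + 1 by ring, Finset.sum_range_succ,
        Finset.sum_range_succ]
    have h2 : auxH p (n + 1) = auxH p n + 1 / ((n + 1 : ℕ) : ℝ) ^ p := by
      unfold auxH; rw [Finset.sum_range_succ]
    have h3 : oddHarmonic (n + 1) p = oddHarmonic n p + 1 / ((n : ℝ) + 1 / 2) ^ p := by
      unfold oddHarmonic; rw [Finset.sum_range_succ]
    have h4 : (2 : ℝ) ^ p * (1 / ((2 * n + 1 : ℕ) : ℝ) ^ p) = 1 / ((n : ℝ) + 1 / 2) ^ p := by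
      rw [show ((2 * n + 1 : ℕ) : ℝ) = 2 * ((n : ℝ) + 1 / 2) by push_cast; ring, mul_pow]
      field_simp
    have h5 : (2 : ℝ) ^ p * (1 / ((2 * n + 2 : ℕ) : ℝ) ^ p) = 1 / ((n + 1 : ℕ) : ℝ) ^ p := by
      rw [show ((2 * n + 2 : ℕ) : ℝ) = 2 * ((n + 1 : ℕ) : ℝ) by push_cast; ring, mul_pow]
      field_simp
    rw [h1, h2, h3, mul_add, mul_add, ih, h4, h5]
    ring

theorem stmt15 (p q : ℕ) (hp : 1 ≤ p) (hq : 2 ≤ q) :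
    SSum p q = (2 ^ (p + q - 1) - 1) * (dzeta q p + zetaVal (p + q))
      + 2 ^ (p + q - 1) * (dzetaAlt q p + zetaAltVal (p + q)) := by
  have hq0 : q ≠ 0 := by omega
  have hA := auxA_summable p q hp hq
  have a1 : dzeta q p + zetaVal (p + q) = ∑' n : ℕ, auxH p n / (n : ℝ) ^ q := by
    have := aux_double p q hp hq (fun _ => 1) (by simp)
    simp only [one_mul] at this
    exact this
  have a2 : dzetaAlt q p + zetaAltVal (p + q)
      = ∑' n : ℕ, (-1 : ℝ) ^ n * (auxH p n / (n : ℝ) ^ q) :=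
    aux_double p q hp hq (fun n => (-1 : ℝ) ^ n) (by simp)
  have hB : Summable fun n : ℕ => (-1 : ℝ) ^ n * (auxH p n / (n : ℝ) ^ q) := by
    refine Summable.of_norm (hA.congr fun n => ?_)
    rw [norm_mul, norm_pow, norm_neg, norm_one, one_pow, one_mul, Real.norm_eq_abs,
      abs_of_nonneg (div_nonneg (auxH_nonneg p n) (by positivity))]
  have i2 : Function.Injective fun n : ℕ => 2 * n := fun a b h => by simpa using h
  have i3 : Function.Injective fun n : ℕ => 2 * n + 1 := fun a b h => by simpa using h
  have hAB := hA.add hB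
  have k1 : (2 : ℝ) ^ (p + q - 1) * ((∑' n : ℕ, auxH p n / (n : ℝ) ^ q)
      + ∑' n : ℕ, (-1 : ℝ) ^ n * (auxH p n / (n : ℝ) ^ q))
      = ∑' n : ℕ, (oddHarmonic n p / (n : ℝ) ^ q + auxH p n / (n : ℝ) ^ q) := by
    have heo := tsum_even_add_odd
      (f := fun n : ℕ => auxH p n / (n : ℝ) ^ q + (-1 : ℝ) ^ n * (auxH p n / (n : ℝ) ^ q))
      (hAB.comp_injective i2) (hAB.comp_injective i3)
    rw [← hA.tsum_add hB, ← heo]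
    have hodd : ∀ n : ℕ, auxH p (2 * n + 1) / ((2 * n + 1 : ℕ) : ℝ) ^ q
        + (-1 : ℝ) ^ (2 * n + 1) * (auxH p (2 * n + 1) / ((2 * n + 1 : ℕ) : ℝ) ^ q) = 0 := by
      intro n; rw [pow_succ, pow_mul]; norm_num
    simp only [hodd, tsum_zero, add_zero]
    rw [← tsum_mul_left]
    refine tsum_congr fun n => ?_
    have e : (2 : ℝ) ^ (p + q - 1) * 2 = 2 ^ p * 2 ^ q := by
      rw [← pow_succ, ← pow_add]; congr 1; omega
    rw [← add_div, ← auxH_two p n hp, pow_mul]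
    push_cast
    rw [mul_pow, neg_one_sq, one_pow, one_mul, ← two_mul, ← mul_assoc, e]
    rw [mul_div_assoc', mul_assoc, mul_comm ((2:ℝ) ^ q), ← mul_assoc,
      mul_comm ((2:ℝ) ^ q), mul_div_mul_right _ _ (by positivity)]
  have hO : Summable fun n : ℕ => oddHarmonic n p / (n : ℝ) ^ q := by
    have h := ((hA.comp_injective i2).mul_left (2 ^ p * 2 ^ q)).sub hA
    refine h.congr fun n => ?_
    have := auxH_two p n hp
    simp only [Function.comp]
    rw [show oddHarmonic n p = 2 ^ p * auxH p (2 * n) - auxH p n by linarith]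
    push_cast
    rw [sub_div, mul_pow]
    congr 1
    rw [mul_div_assoc', mul_assoc, mul_comm ((2:ℝ) ^ q), ← mul_assoc,
      mul_comm ((2:ℝ) ^ q), mul_div_mul_right _ _ (by positivity)]
  have k2 : SSum p q = ∑' n : ℕ, oddHarmonic n p / (n : ℝ) ^ q := by
    rw [hO.tsum_eq_zero_add]
    simp [SSum, hq0]
  rw [hO.tsum_add hA] at k1
  rw [a1, a2, k2]
  linarith
end
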